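/- A subgroup Q of prime power order of a finite group G is submodular in G if and only if Q is K𝔘₁-subnormal in G, where 𝔘₁ is the class of supersolvable groups of square-free exponent. -/

import Mathlib

universe u

/-- A class of groups is subgroup-closed if it is closed under taking subgroups. -/
def IsSubgroupClosed (F : ∀ (G : Type u) [Group G], Prop) : Prop :=
  ∀ (G : Type u) [Group G] (H : Subgroup G), F G → F H

/-- A formation: a class of groups closed under isomorphisms, quotients and
subdirect products. -/
structure IsFormation (F : ∀ (G : Type u) [Group G], Prop) : Prop where
  iso : ∀ (G H : Type u) [Group G] [Group H], G ≃* H → F G → F H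
  quot : ∀ (G : Type u) [Group G] (N : Subgroup G) (_ : N.Normal), F G → F (G ⧸ N)
  subdirect : ∀ (G : Type u) [Group G] (N₁ N₂ : Subgroup G) (_ : N₁.Normal) (_ : N₂.Normal),
    F (G ⧸ N₁) → F (G ⧸ N₂) → N₁ ⊓ N₂ = ⊥ → F G

/-- The 𝔉-fResidual of `G`: the smallest normal subgroup with quotient in `F`. -/
def fResidual (F : ∀ (G : Type u) [Group G], Prop) (G : Type u) [Group G] : Subgroup G :=
  sInf {N : Subgroup G | ∃ _ : N.Normal, F (G ⧸ N)}

/-- `KSubnormal F H K` : there is a chain `H = H₀ ≤ … ≤ Hₙ = K` of subgroups of `G`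
such that each `Hᵢ` is normal in `Hᵢ₊₁` or contains the `F`-fResidual of `Hᵢ₊₁`. -/
inductive KSubnormal (F : ∀ (G : Type u) [Group G], Prop) {G : Type u} [Group G] :
    Subgroup G → Subgroup G → Prop
  | refl (H : Subgroup G) : KSubnormal F H H
  | step {H K L : Subgroup G} : KSubnormal F H K → K ≤ L →
      ((K.subgroupOf L).Normal ∨ fResidual F ↥L ≤ K.subgroupOf L) → KSubnormal F H L

/-- `M` is a modular element of the subgroup lattice of `G`. -/
def IsModularSubgroup {G : Type u} [Group G] (M : Subgroup G) : Prop :=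
  (∀ X Y : Subgroup G, X ≤ Y → (X ⊔ M) ⊓ Y = X ⊔ (M ⊓ Y)) ∧
  (∀ X Y : Subgroup G, M ≤ Y → (M ⊔ X) ⊓ Y = M ⊔ (X ⊓ Y))

/-- `Submodular H K` : a chain from `H` to `K` with each term modular in the next. -/
inductive Submodular {G : Type u} [Group G] : Subgroup G → Subgroup G → Prop
  | refl (H : Subgroup G) : Submodular H H
  | step {H K L : Subgroup G} : Submodular H K → K ≤ L →
      IsModularSubgroup (K.subgroupOf L) → Submodular H L

/-- `SubnormalIn H K` : a chain from `H` to `K` with each term normal in the next. -/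
inductive SubnormalIn {G : Type u} [Group G] : Subgroup G → Subgroup G → Prop
  | refl (H : Subgroup G) : SubnormalIn H H
  | step {H K L : Subgroup G} : SubnormalIn H K → K ≤ L →
      (K.subgroupOf L).Normal → SubnormalIn H L

/-- A group is supersolvable if it has a normal series with cyclic factors:
each term is normal in `G` and each successive term is generated by the previous
one together with a single element. -/
def IsSupersolvable (G : Type u) [Group G] : Prop :=
  ∃ (n : ℕ) (s : Fin (n + 1) → Subgroup G), s 0 = ⊥ ∧ s (Fin.last n) = ⊤ ∧
    (∀ i, (s i).Normal) ∧
    ∀ i : Fin n, ∃ g : G, s i.succ = s i.castSucc ⊔ Subgroup.zpowers g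

/-- The class 𝔘₁ of supersolvable groups of square-free exponent. -/
def U1 : ∀ (G : Type u) [Group G], Prop := fun G _ =>
  IsSupersolvable G ∧ Squarefree (Monoid.exponent G)

/-- The solvable radical: the largest normal solvable subgroup. -/
def solvRad (G : Type u) [Group G] : Subgroup G :=
  sSup {N : Subgroup G | N.Normal ∧ IsSolvable ↥N}

/-- The Fitting subgroup: the largest normal nilpotent subgroup. -/
def fitting (G : Type u) [Group G] : Subgroup G :=
  sSup {N : Subgroup G | N.Normal ∧ Group.IsNilpotent ↥N}

/-- Relative modularity inside a lattice: `m` is a modular element of the interval below `l`. -/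
def LMod {α : Type*} [Lattice α] (m l : α) : Prop :=
  m ≤ l ∧ (∀ x y, x ≤ y → y ≤ l → (x ⊔ m) ⊓ y ≤ x ⊔ (m ⊓ y)) ∧
    (∀ x y, m ≤ y → y ≤ l → x ≤ l → (m ⊔ x) ⊓ y ≤ m ⊔ (x ⊓ y))

section lattice
variable {α : Type*} [Lattice α]

theorem LMod.inf {m l : α} (h : LMod m l) {k : α} (hk : k ≤ l) : LMod (m ⊓ k) k := by
  obtain ⟨hml, h1, h2⟩ := h
  refine ⟨inf_le_right, ?_, ?_⟩
  · intro x y hxy hy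
    calc (x ⊔ (m ⊓ k)) ⊓ y ≤ (x ⊔ m) ⊓ y := by gcongr; exact inf_le_left
      _ ≤ x ⊔ (m ⊓ y) := h1 x y hxy (hy.trans hk)
      _ ≤ x ⊔ (m ⊓ k ⊓ y) := by
        exact sup_le_sup_left
          (le_inf (le_inf inf_le_left (inf_le_right.trans hy)) inf_le_right) x
  · intro x y hmy hy hx
    have e1 : (y ⊔ m) ⊓ k ≤ y := (h1 y k hy hk).trans (sup_le le_rfl hmy)
    have e2 : x ⊓ (y ⊔ m) ≤ x ⊓ y :=
      le_inf inf_le_left ((le_inf inf_le_right (inf_le_left.trans hx)).trans e1)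
    have e3 : (m ⊔ x) ⊓ (y ⊔ m) ≤ m ⊔ (x ⊓ y) :=
      (h2 x (y ⊔ m) le_sup_right (sup_le (hy.trans hk) hml) (hx.trans hk)).trans
        (sup_le_sup_left e2 m)
    have e4 : (m ⊓ k ⊔ x) ⊓ y ≤ (x ⊓ y ⊔ m) ⊓ k := by
      refine le_inf ?_ (inf_le_right.trans hy)
      rw [sup_comm (x ⊓ y)]
      refine le_trans ?_ e3
      exact inf_le_inf (sup_le_sup_right inf_le_left x) le_sup_left
    refine e4.trans ((h1 (x ⊓ y) k (inf_le_left.trans hx) hk).trans ?_)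
    rw [sup_comm]

theorem LMod.mono {m l k : α} (h : LMod m l) (hm : m ≤ k) (hk : k ≤ l) : LMod m k := by
  have := h.inf hk
  rwa [inf_eq_left.2 hm] at this

theorem LMod.rfl' (m : α) : LMod m m :=
  ⟨le_rfl, fun _ _ _ hy => inf_le_right.trans (le_sup_of_le_right (le_inf hy le_rfl)),
    fun _ _ _ hy _ => inf_le_right.trans (le_sup_of_le_left hy)⟩

/-- Modularity can be tested in the interval above a modular element. -/
theorem LMod.of_interval {d m l : α} (hd : LMod d l) (hdm : d ≤ m) (hml : m ≤ l)
    (h1 : ∀ x y, d ≤ x → x ≤ y → y ≤ l → (x ⊔ m) ⊓ y ≤ x ⊔ (m ⊓ y))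
    (h2 : ∀ x y, d ≤ x → m ≤ y → y ≤ l → x ≤ l → (m ⊔ x) ⊓ y ≤ m ⊔ (x ⊓ y)) : LMod m l := by
  obtain ⟨hdl, d1, d2⟩ := hd
  refine ⟨hml, ?_, ?_⟩
  · intro x y hxy hy
    have a1 := h1 (x ⊔ d) (y ⊔ d) le_sup_right (sup_le_sup_right hxy d) (sup_le hy hdl)
    have a2 : m ⊓ (y ⊔ d) ≤ d ⊔ (m ⊓ y) := by
      have := d2 y m hdm hml hy
      rw [inf_comm m, sup_comm y, inf_comm m]; exact this
    have a3 : (x ⊔ m) ⊓ y ≤ (x ⊔ (m ⊓ y) ⊔ d) ⊓ y := by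
      refine le_inf ?_ inf_le_right
      refine (le_trans (inf_le_inf ?_ le_sup_left) a1).trans ?_
      · exact sup_le_sup_right le_sup_left m
      · refine sup_le (sup_le (le_sup_left.trans le_sup_left) le_sup_right) (a2.trans ?_)
        exact sup_le le_sup_right (le_sup_right.trans le_sup_left)
    refine a3.trans ((d1 (x ⊔ (m ⊓ y)) y (sup_le hxy inf_le_right) hy).trans ?_)
    exact sup_le le_rfl (le_sup_of_le_right (inf_le_inf_right y hdm))
  · intro x y hmy hy hx
    have a1 := h2 (x ⊔ d) y le_sup_right hmy hy (sup_le hx hdl)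
    have a2 := d2 x y (hdm.trans hmy) hy hx
    refine (inf_le_inf_right y (sup_le_sup_left le_sup_left m)).trans (a1.trans ?_)
    rw [sup_comm x d]
    exact sup_le le_sup_left (a2.trans (sup_le (hdm.trans le_sup_left) le_sup_right))

theorem LMod.sup {m n l : α} (hm : LMod m l) (hn : LMod n l) : LMod (m ⊔ n) l := by
  obtain ⟨hml, m1, m2⟩ := hm
  obtain ⟨hnl, n1, n2⟩ := hn
  refine ⟨sup_le hml hnl, ?_, ?_⟩
  · intro x' y' hxy' hy'
    set s := m ⊔ n with hs
    have hsl : s ≤ l := sup_le hml hnl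
    set x := x' ⊔ (s ⊓ y') with hx
    set y := (x' ⊔ s) ⊓ y' with hy
    have hxy : x ≤ y := sup_le (le_inf le_sup_left hxy')
      (le_inf (inf_le_left.trans le_sup_right) inf_le_right)
    have hyl : y ≤ l := inf_le_right.trans hy'
    have e1 : y ⊓ s ≤ x := (le_inf inf_le_right (inf_le_left.trans inf_le_right)).trans le_sup_right
    have e2 : y ≤ x ⊔ s := inf_le_left.trans (sup_le_sup_right le_sup_left s)
    have f1 : (y ⊔ m) ⊓ s ≤ m ⊔ x := by
      rw [sup_comm]
      exact (m2 y s le_sup_left hsl hyl).trans (sup_le_sup_left e1 m)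
    have f2 : y ⊔ m ≤ x ⊔ m := by
      have a := n1 (x ⊔ m) (y ⊔ m) (sup_le_sup_right hxy m) (sup_le hyl hml)
      have b : y ⊔ m ≤ (x ⊔ m ⊔ n) ⊓ (y ⊔ m) := by
        refine le_inf ?_ le_rfl
        rw [sup_assoc]
        exact sup_le e2 (le_sup_left.trans le_sup_right)
      refine b.trans (a.trans (sup_le le_rfl ?_))
      rw [sup_comm x m]
      exact (le_inf inf_le_right (inf_le_left.trans le_sup_right)).trans f1
    have f3 : y ≤ x := by
      refine (le_inf (le_sup_left.trans f2) le_rfl).trans ((m1 x y hxy hyl).trans ?_)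
      exact sup_le le_rfl ((le_inf inf_le_right (inf_le_left.trans le_sup_left)).trans e1)
    exact f3
  · intro x y hy hyl hx
    have a := m2 (n ⊔ x) y (le_sup_left.trans hy) hyl (sup_le hnl hx)
    have b := n2 x y (le_sup_right.trans hy) hyl hx
    rw [sup_assoc, sup_assoc]
    exact a.trans (sup_le_sup_left b m)

end lattice

section transfer
variable {G : Type*} [Group G]

theorem map_le_iff_sub {L : Subgroup G} {A B : Subgroup L} :
    A.map L.subtype ≤ B.map L.subtype ↔ A ≤ B :=
  Subgroup.map_le_map_iff_of_injective L.subtype_injective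

theorem exists_map {L X : Subgroup G} (h : X ≤ L) : ∃ Y : Subgroup L, Y.map L.subtype = X :=
  ⟨X.subgroupOf L, Subgroup.map_subgroupOf_eq_of_le h⟩

theorem lmod_map_iff {L : Subgroup G} {A B : Subgroup L} :
    LMod (A.map L.subtype) (B.map L.subtype) ↔ LMod A B := by
  have hle : ∀ C : Subgroup L, C.map L.subtype ≤ L := fun C => Subgroup.map_subtype_le C
  have hinf : ∀ C D : Subgroup L, C.map L.subtype ⊓ D.map L.subtype = (C ⊓ D).map L.subtype :=
    fun C D => (Subgroup.map_inf C D _ L.subtype_injective).symm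
  constructor
  · rintro ⟨h0, h1, h2⟩
    refine ⟨map_le_iff_sub.1 h0, fun x y hxy hy => ?_, fun x y hxy hy hx => ?_⟩
    · have := h1 _ _ (map_le_iff_sub.2 hxy) (map_le_iff_sub.2 hy)
      simpa only [← Subgroup.map_sup, hinf, map_le_iff_sub] using this
    · have := h2 _ _ (map_le_iff_sub.2 hxy) (map_le_iff_sub.2 hy) (map_le_iff_sub.2 hx)
      simpa only [← Subgroup.map_sup, hinf, map_le_iff_sub] using this
  · rintro ⟨h0, h1, h2⟩
    refine ⟨map_le_iff_sub.2 h0, fun x y hxy hy => ?_, fun x y hxy hy hx => ?_⟩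
    · obtain ⟨y, rfl⟩ := exists_map (hy.trans (hle B))
      obtain ⟨x, rfl⟩ := exists_map (hxy.trans (hle y))
      simp only [← Subgroup.map_sup, hinf, map_le_iff_sub] at hxy hy ⊢
      exact h1 x y hxy hy
    · obtain ⟨y, rfl⟩ := exists_map (hy.trans (hle B))
      obtain ⟨x, rfl⟩ := exists_map (hx.trans (hle B))
      simp only [← Subgroup.map_sup, hinf, map_le_iff_sub] at hxy hy hx ⊢
      exact h2 x y hxy hy hx

theorem lmod_subgroupOf {K L : Subgroup G} (h : K ≤ L) :
    LMod (K.subgroupOf L) ⊤ ↔ LMod K L := by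
  rw [← lmod_map_iff, Subgroup.map_subgroupOf_eq_of_le h, ← MonoidHom.range_eq_map,
    Subgroup.range_subtype]

theorem lmod_comap {H : Type*} [Group H] {f : G →* H} (hf : Function.Surjective f)
    (hk : LMod f.ker ⊤) {m l : Subgroup H} (h : LMod m l) :
    LMod (m.comap f) (l.comap f) := by
  obtain ⟨h0, h1, h2⟩ := h
  have key : ∀ x : Subgroup G, f.ker ≤ x → ∃ y : Subgroup H, y.comap f = x := fun x hx =>
    ⟨x.map f, by rw [Subgroup.comap_map_eq, sup_eq_left.2 hx]⟩
  have hle : ∀ x y : Subgroup H, x.comap f ≤ y.comap f ↔ x ≤ y := fun x y =>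
    Subgroup.comap_le_comap_of_surjective hf
  have kl : ∀ x : Subgroup H, f.ker ≤ x.comap f := fun x => by
    rw [← MonoidHom.comap_bot]; exact Subgroup.comap_mono bot_le
  refine LMod.of_interval (d := f.ker) (hk.mono (kl l) le_top) (kl m) ((hle _ _).2 h0) ?_ ?_
  · intro x y hx hxy hy
    obtain ⟨y, rfl⟩ := key y (hx.trans hxy)
    obtain ⟨x, rfl⟩ := key x hx
    rw [hle] at hxy hy
    rw [Subgroup.comap_sup_eq f _ _ hf, ← Subgroup.comap_inf, ← Subgroup.comap_inf,
      Subgroup.comap_sup_eq f _ _ hf, hle]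
    exact h1 x y hxy hy
  · intro x y hx hmy hy hxl
    obtain ⟨y, rfl⟩ := key y ((kl m).trans hmy)
    obtain ⟨x, rfl⟩ := key x hx
    rw [hle] at hmy hy hxl
    rw [Subgroup.comap_sup_eq f _ _ hf, ← Subgroup.comap_inf, ← Subgroup.comap_inf,
      Subgroup.comap_sup_eq f _ _ hf, hle]
    exact h2 x y hmy hy hxl

theorem lmod_of_comap {H : Type*} [Group H] {f : G →* H} (hf : Function.Surjective f)
    {m l : Subgroup H} (h : LMod (m.comap f) (l.comap f)) : LMod m l := by
  have hle : ∀ x y : Subgroup H, x.comap f ≤ y.comap f ↔ x ≤ y := fun x y =>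
    Subgroup.comap_le_comap_of_surjective hf
  obtain ⟨h0, h1, h2⟩ := h
  refine ⟨(hle _ _).1 h0, fun x y hxy hy => ?_, fun x y hxy hy hx => ?_⟩
  · have := h1 _ _ ((hle _ _).2 hxy) ((hle _ _).2 hy)
    simpa only [Subgroup.comap_sup_eq f _ _ hf, ← Subgroup.comap_inf, hle] using this
  · have := h2 _ _ ((hle _ _).2 hxy) ((hle _ _).2 hy) ((hle _ _).2 hx)
    simpa only [Subgroup.comap_sup_eq f _ _ hf, ← Subgroup.comap_inf, hle] using this

theorem lmod_of_normal {N : Subgroup G} (hN : N.Normal) : LMod N ⊤ := by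
  refine ⟨le_top, fun x y hxy _ => ?_, fun x y hxy _ _ => ?_⟩
  · rintro g ⟨hg, hgy⟩
    obtain ⟨a, ha, b, hb, rfl⟩ := Subgroup.mem_sup_of_normal_right.1 hg
    refine mul_mem (Subgroup.mem_sup_left ha) (Subgroup.mem_sup_right ⟨hb, ?_⟩)
    exact (Subgroup.mul_mem_cancel_left y (hxy ha)).1 hgy
  · rintro g ⟨hg, hgy⟩
    obtain ⟨a, ha, b, hb, rfl⟩ := Subgroup.mem_sup_of_normal_left.1 hg
    refine mul_mem (Subgroup.mem_sup_left ha) (Subgroup.mem_sup_right ⟨hb, ?_⟩)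
    exact (Subgroup.mul_mem_cancel_left y (hxy ha)).1 hgy

theorem lmod_of_normal_sub {K L : Subgroup G} (h : K ≤ L) (hN : (K.subgroupOf L).Normal) :
    LMod K L := (lmod_subgroupOf h).1 (lmod_of_normal hN)

theorem lmod_comap_top {H : Type*} [Group H] {f : G →* H} (hf : Function.Surjective f)
    {m : Subgroup H} (h : LMod m ⊤) : LMod (m.comap f) ⊤ := by
  have := lmod_comap hf (lmod_of_normal inferInstance) h
  rwa [Subgroup.comap_top] at this

end transfer

theorem isModular_iff {G : Type u} [Group G] {M : Subgroup G} :
    IsModularSubgroup M ↔ LMod M ⊤ := by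
  constructor
  · rintro ⟨h1, h2⟩
    exact ⟨le_top, fun x y hxy _ => (h1 x y hxy).le, fun x y hxy _ _ => (h2 x y hxy).le⟩
  · rintro ⟨-, h1, h2⟩
    refine ⟨fun x y hxy => le_antisymm (h1 x y hxy le_top) ?_,
      fun x y hxy => le_antisymm (h2 x y hxy le_top le_top) ?_⟩
    · exact sup_le (le_inf le_sup_left hxy) (inf_le_inf_right _ le_sup_right)
    · exact sup_le (le_inf le_sup_left hxy) (inf_le_inf_right _ le_sup_right)

theorem isModular_sub_iff {G : Type u} [Group G] {K L : Subgroup G} (h : K ≤ L) :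
    IsModularSubgroup (K.subgroupOf L) ↔ LMod K L :=
  isModular_iff.trans (lmod_subgroupOf h)

section submod
variable {G : Type u} [Group G]

theorem Submodular.step' {H K L : Subgroup G} (h : Submodular H K) (hm : LMod K L) :
    Submodular H L := .step h hm.1 ((isModular_sub_iff hm.1).2 hm)

theorem Submodular.of_lmod {K L : Subgroup G} (hm : LMod K L) : Submodular K L :=
  (Submodular.refl K).step' hm

theorem Submodular.le {H K : Subgroup G} (h : Submodular H K) : H ≤ K := by
  induction h with
  | refl => exact le_rfl
  | step _ h _ ih => exact ih.trans h

theorem Submodular.trans' {H K L : Subgroup G} (h : Submodular H K) (h' : Submodular K L) :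
    Submodular H L := by
  induction h' with
  | refl => exact h
  | step _ h1 h2 ih => exact .step ih h1 h2

theorem Submodular.inf' {H K : Subgroup G} (h : Submodular H K) (Z : Subgroup G) :
    Submodular (H ⊓ Z) (K ⊓ Z) := by
  induction h with
  | refl => exact .refl _
  | @step K L _ h1 h2 ih =>
    refine ih.step' ?_
    have := ((isModular_sub_iff h1).1 h2).inf (k := L ⊓ Z) inf_le_left
    rwa [← inf_assoc, inf_eq_left.2 h1] at this

theorem Submodular.map_sub {L : Subgroup G} {A B : Subgroup L} (h : Submodular A B) :
    Submodular (A.map L.subtype) (B.map L.subtype) := by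
  induction h with
  | refl => exact .refl _
  | step _ h1 h2 ih => exact ih.step' (lmod_map_iff.2 ((isModular_sub_iff h1).1 h2))

theorem Submodular.comap' {H : Type u} [Group H] {f : G →* H} (hf : Function.Surjective f)
    {A B : Subgroup H} (h : Submodular A B) : Submodular (A.comap f) (B.comap f) := by
  induction h with
  | refl => exact .refl _
  | step _ h1 h2 ih =>
    exact ih.step' (lmod_comap hf (lmod_of_normal inferInstance) ((isModular_sub_iff h1).1 h2))

end submod

section schmidt

/-- If every nontrivial subgroup of a nontrivial finite group is everything, its order is prime. -/
theorem card_prime_of_coatom_bot {H : Type*} [Group H] [Finite H]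
    (h : IsCoatom (⊥ : Subgroup H)) : (Nat.card H).Prime := by
  have hnt : Nat.card H ≠ 1 := by
    intro h1
    apply h.1
    have := (Nat.card_eq_one_iff_unique.1 h1).1
    exact Subsingleton.elim _ _
  have hp := Nat.minFac_prime hnt
  have := Fact.mk hp
  obtain ⟨x, hx⟩ := exists_prime_orderOf_dvd_card' (G := H) _ (Nat.minFac_dvd (Nat.card H))
  have hz : Subgroup.zpowers x = ⊤ := by
    apply h.2
    rw [bot_lt_iff_ne_bot, Ne, Subgroup.zpowers_eq_bot]
    rintro rfl
    rw [orderOf_one] at hx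
    exact hp.one_lt.ne hx
  have : Nat.card H = (Nat.card H).minFac := by
    rw [← hx, ← Nat.card_zpowers, hz, Subgroup.card_top]
  rw [this]; exact hp

theorem commutator_le_of_coatom {H : Type*} [Group H] {M : Subgroup H} (hN : M.Normal)
    (h : IsCoatom M) : commutator H ≤ M := by
  obtain ⟨y, hy⟩ : ∃ y, y ∉ M := by
    by_contra! hc
    exact h.1 (eq_top_iff.2 fun x _ => hc x)
  have ht : M ⊔ Subgroup.zpowers y = ⊤ := by
    apply h.2
    refine lt_of_le_of_ne le_sup_left fun e => hy ?_
    rw [e]; exact Subgroup.mem_sup_right (Subgroup.mem_zpowers y)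
  rw [commutator_def, Subgroup.commutator_le]
  have hrep : ∀ g : H, ∃ k : ℤ, (QuotientGroup.mk g : H ⧸ M) = (QuotientGroup.mk y) ^ k := by
    intro g
    have hg : g ∈ M ⊔ Subgroup.zpowers y := by rw [ht]; trivial
    obtain ⟨a, ha, b, ⟨k, rfl⟩, rfl⟩ := Subgroup.mem_sup_of_normal_left.1 hg
    refine ⟨k, ?_⟩
    rw [QuotientGroup.mk_mul, (QuotientGroup.eq_one_iff a).2 ha, one_mul]; rfl
  intro g₁ _ g₂ _
  rw [← QuotientGroup.eq_one_iff]
  obtain ⟨k, hk⟩ := hrep g₁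
  obtain ⟨l, hl⟩ := hrep g₂
  rw [commutatorElement_def, QuotientGroup.mk_mul, QuotientGroup.mk_mul, QuotientGroup.mk_mul,
    QuotientGroup.mk_inv, QuotientGroup.mk_inv, hk, hl]
  group

theorem coatom_of_index_prime {H : Type*} [Group H] {M : Subgroup H} (h : M.index.Prime) :
    IsCoatom M := by
  refine ⟨fun e => ?_, fun b hb => ?_⟩
  · rw [e, Subgroup.index_top] at h; exact Nat.not_prime_one h
  · have := Subgroup.relIndex_mul_index hb.le
    have hd : b.index ∣ M.index := ⟨_, by rw [mul_comm]; exact this.symm⟩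
    rcases (Nat.dvd_prime h).1 hd with h1 | h1
    · exact Subgroup.index_eq_one.1 h1
    · exfalso
      rw [h1] at this
      have : M.relIndex b = 1 := by
        have h0 := h.pos
        nlinarith
      exact hb.not_ge (Subgroup.relIndex_eq_one.1 this)

/-- The conclusion of the theorem of Schmidt. -/
def SchmidtConc {H : Type*} [Group H] (M : Subgroup H) : Prop :=
  M.Normal ∨ ∃ D A : Subgroup H, D.Normal ∧ A.Normal ∧ D ≤ A ∧ D ≤ M ∧
    ∃ r s : ℕ, r.Prime ∧ s.Prime ∧ s < r ∧ D.relIndex A = r ∧ A.index = s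

theorem SchmidtConc.commutator_ne_top {H : Type*} [Group H] {M : Subgroup H} (hM : IsCoatom M)
    (h : SchmidtConc M) : commutator H ≠ ⊤ := by
  intro e
  rcases h with h | ⟨D, A, hD, hA, hDA, hDM, r, s, hr, hs, hsr, h1, h2⟩
  · exact hM.1 (eq_top_iff.2 (e ▸ commutator_le_of_coatom h hM))
  · have hc : IsCoatom A := coatom_of_index_prime (h2 ▸ hs)
    exact hc.1 (eq_top_iff.2 (e ▸ commutator_le_of_coatom hA hc))

theorem SchmidtConc.comm_le {H : Type*} [Group H] [Finite H] {M : Subgroup H} (hM : IsCoatom M)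
    (h : SchmidtConc M) {P : Subgroup H} (hP : P.Normal) {p : ℕ} (hp : p.Prime)
    (hPp : IsPGroup p P)
    (hmin : ∀ q : ℕ, q.Prime → q ∣ Nat.card H → p ≤ q) : ⁅(⊤ : Subgroup H), P⁆ ≤ M := by
  rcases h with h | ⟨D, A, hD, hA, hDA, hDM, r, s, hr, hs, hsr, h1, h2⟩
  · refine le_trans ?_ (commutator_le_of_coatom h hM)
    rw [commutator_def]
    exact Subgroup.commutator_mono le_rfl le_top
  · have hc : IsCoatom A := coatom_of_index_prime (h2 ▸ hs)
    have ha : ⁅(⊤ : Subgroup H), P⁆ ≤ A := by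
      refine le_trans ?_ (commutator_le_of_coatom hA hc)
      rw [commutator_def]
      exact Subgroup.commutator_mono le_rfl le_top
    have hb : ⁅(⊤ : Subgroup H), P⁆ ≤ P := Subgroup.commutator_le_right _ _
    refine le_trans (le_trans (le_inf hb ha) ?_) hDM
    rintro x ⟨hxP, hxA⟩
    have hps : p ≤ s := hmin s hs (h2 ▸ A.index_dvd_card)
    have e1 : x ^ r ∈ D := by
      have := D.pow_relIndex_mem hxA
      rwa [h1] at this
    obtain ⟨k, hk⟩ := hPp ⟨x, hxP⟩
    have hk : x ^ p ^ k = 1 := congrArg Subtype.val hk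
    have hcop : Nat.Coprime r (p ^ k) := by
      apply Nat.Coprime.pow_right
      rw [Nat.coprime_primes hr hp]; omega
    have e2 : x ^ (Nat.gcd r (p ^ k) : ℤ) ∈ D := by
      rw [Nat.gcd_eq_gcd_ab, zpow_add, zpow_mul, zpow_mul, zpow_natCast, zpow_natCast, hk, one_zpow,
        mul_one]
      exact D.zpow_mem e1 _
    rw [hcop.gcd_eq_one] at e2
    simpa using e2

theorem coatom_subgroupOf {H : Type*} [Group H] {M X : Subgroup H} (hM : IsCoatom M)
    (hm : LMod M ⊤) (hX : ¬ X ≤ M) : IsCoatom (M.subgroupOf X) ∧ LMod (M.subgroupOf X) ⊤ := by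
  have e : M.subgroupOf X = (M ⊓ X).subgroupOf X := by simp
  constructor
  · refine ⟨fun h => hX (Subgroup.subgroupOf_eq_top.1 h), fun Z hZ => ?_⟩
    have h1 := hm.2.1 (Z.map X.subtype) X (Subgroup.map_subtype_le Z) le_top
    have h2 : M ⊓ X ≤ Z.map X.subtype := by
      have := (map_le_iff_sub (L := X)).2 hZ.le
      rwa [Subgroup.subgroupOf_map_subtype] at this
    rw [sup_eq_left.2 h2] at h1
    rcases hM.le_iff.1 (show M ≤ Z.map X.subtype ⊔ M from le_sup_right) with h3 | h3
    · rw [h3, top_inf_eq] at h1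
      refine eq_top_iff.2 fun x _ => ?_
      obtain ⟨z, hz, hzx⟩ := h1 x.2
      have : z = x := Subtype.ext hzx
      exact this ▸ hz
    · exfalso
      refine hZ.not_ge fun z hz => ?_
      have : (z : H) ∈ Z.map X.subtype ⊔ M := Subgroup.mem_sup_left ⟨z, hz, rfl⟩
      rw [h3] at this
      exact this
  · rw [e, lmod_subgroupOf inf_le_right]
    exact hm.inf le_top

theorem normal_of_normalized {H : Type*} [Group H] {A B C : Subgroup H} (h : A ⊔ B = ⊤)
    (h1 : ∀ a ∈ A, ∀ c ∈ C, a * c * a⁻¹ ∈ C) (h2 : ∀ a ∈ B, ∀ c ∈ C, a * c * a⁻¹ ∈ C) :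
    C.Normal := by
  have key : ∀ D : Subgroup H, (∀ a ∈ D, ∀ c ∈ C, a * c * a⁻¹ ∈ C) →
      D ≤ Subgroup.normalizer (C : Set H) := by
    intro D hD a ha
    rw [Subgroup.mem_normalizer_iff]
    refine fun c => ⟨hD a ha c, fun hc => ?_⟩
    have := hD a⁻¹ (D.inv_mem ha) _ hc
    simpa [mul_assoc] using this
  rw [← Subgroup.normalizer_eq_top_iff, eq_top_iff, ← h]
  exact sup_le (key A h1) (key B h2)

theorem isPGroup_coatom_normal {H : Type*} [Group H] [Finite H] {p : ℕ} (hp : p.Prime)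
    (h : IsPGroup p H) {M : Subgroup H} (hM : IsCoatom M) : M.Normal := by
  have := Fact.mk hp
  have := h.isNilpotent
  exact Subgroup.NormalizerCondition.normal_of_coatom M Group.normalizerCondition_of_isNilpotent hM

theorem comap_conj_coatom {H : Type*} [Group H] {M : Subgroup H} (hM : IsCoatom M) (g : H) :
    IsCoatom (M.comap (MulAut.conj g).toMonoidHom) := by
  exact ((MulAut.conj g).comapSubgroup.isCoatom_iff M).2 hM

theorem map_coatom {H K : Type*} [Group H] [Group K] {f : H →* K} (hf : Function.Surjective f)
    {M : Subgroup K} : IsCoatom (M.comap f) → IsCoatom M := by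
  intro h
  refine ⟨fun e => h.1 (by rw [e, Subgroup.comap_top]), fun b hb => ?_⟩
  have := h.2 (b.comap f) ((Subgroup.comap_lt_comap_of_surjective hf).2 hb)
  apply Subgroup.comap_injective hf
  rw [this, Subgroup.comap_top]

theorem SchmidtConc.comap {H K : Type*} [Group H] [Group K] {f : H →* K}
    (hf : Function.Surjective f) {M : Subgroup K} (h : SchmidtConc M) :
    SchmidtConc (M.comap f) := by
  rcases h with h | ⟨D, A, hD, hA, hDA, hDM, r, s, hr, hs, hsr, h1, h2⟩
  · exact .inl (h.comap f)
  · refine .inr ⟨D.comap f, A.comap f, hD.comap f, hA.comap f, Subgroup.comap_mono hDA,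
      Subgroup.comap_mono hDM, r, s, hr, hs, hsr, ?_, ?_⟩
    · rw [Subgroup.relIndex_comap, Subgroup.map_comap_eq_self_of_surjective hf, h1]
    · rw [Subgroup.index_comap_of_surjective _ hf, h2]

theorem le_normalCore_of_forall {H : Type*} [Group H] {M C : Subgroup H}
    (h : ∀ g : H, C ≤ M.comap (MulAut.conj g).toMonoidHom) : C ≤ M.normalCore := by
  intro x hx g
  exact h g hx

theorem schmidt_nonsimple {H : Type u} [Group H] [Finite H] {M : Subgroup H}
    (hM : IsCoatom M) (hm : LMod M ⊤) (hcore : M.normalCore = ⊥)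
    (hIH : ∀ X : Subgroup H, X ≠ ⊤ → ∀ N : Subgroup X, IsCoatom N → LMod N ⊤ → SchmidtConc N)
    (hns : ∃ A : Subgroup H, A.Normal ∧ A ≠ ⊥ ∧ A ≠ ⊤) : SchmidtConc M := by
  by_cases hMn : M.Normal
  · exact .inl hMn
  obtain ⟨A0, hA0⟩ := hns
  obtain ⟨A, hAA0, hAmin⟩ := exists_minimal_le_of_wellFoundedLT
    (fun A : Subgroup H => A.Normal ∧ A ≠ ⊥ ∧ A ≠ ⊤) A0 hA0
  obtain ⟨⟨hAn, hAb, hAt⟩, hAm⟩ := hAmin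
  have small : ∀ C : Subgroup H, C.Normal → C ≤ M → C = ⊥ := fun C hC hCM =>
    le_bot_iff.1 (hcore ▸ Subgroup.normal_le_normalCore.2 hCM)
  have hAM : ¬ A ≤ M := fun h => hAb (small A hAn h)
  obtain ⟨hc1, hc2⟩ := coatom_subgroupOf hM hm hAM
  have hcomm : ⁅A, A⁆ = ⊥ := by
    by_contra hne
    have hn : ⁅A, A⁆.Normal := inferInstance
    have hle : ⁅A, A⁆ ≤ A := Subgroup.commutator_le_right _ _
    have hge := hAm ⟨hn, hne, fun e => hAt (eq_top_iff.2 (e ▸ hle))⟩ hle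
    refine (hIH A hAt _ hc1 hc2).commutator_ne_top hc1 ?_
    apply Subgroup.map_injective A.subtype_injective
    rw [Subgroup.map_subtype_commutator, ← MonoidHom.range_eq_map, Subgroup.range_subtype]
    exact le_antisymm hle hge
  have hAc : ∀ a ∈ A, ∀ b ∈ A, a * b = b * a := by
    rw [Subgroup.commutator_eq_bot_iff_le_centralizer] at hcomm
    intro a ha b hb
    exact (Subgroup.mem_centralizer_iff.1 (hcomm ha) b hb).symm
  have hMA : M ⊔ A = ⊤ := hM.2 _ (lt_of_le_of_ne le_sup_left fun e => hAM (e ▸ le_sup_right))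
  have hinf : M ⊓ A = ⊥ := by
    refine small _ (normal_of_normalized hMA ?_ ?_) inf_le_left
    · rintro a ha c ⟨hc, hc'⟩
      exact ⟨M.mul_mem (M.mul_mem ha hc) (M.inv_mem ha), hAn.conj_mem c hc' a⟩
    · rintro a ha c ⟨hc, hc'⟩
      rw [hAc a ha c hc', mul_inv_cancel_right]
      exact ⟨hc, hc'⟩
  have hbotA : M.subgroupOf A = ⊥ := by
    rw [Subgroup.subgroupOf_eq_bot, disjoint_iff, hinf]
  rw [hbotA] at hc1
  have hr : (Nat.card A).Prime := card_prime_of_coatom_bot hc1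
  have := Fact.mk hr
  have hcyc : IsCyclic A := isCyclic_of_prime_card rfl
  -- the action of `M` on `A`
  let φ : M →* MulAut A := (MulAut.conjNormal (H := A)).comp M.subtype
  have hφ : Function.Injective φ := by
    rw [injective_iff_map_eq_one]
    have hC : (M ⊓ Subgroup.centralizer (A : Set H)) = ⊥ := by
      refine small _ (normal_of_normalized hMA ?_ ?_) inf_le_left
      · rintro a ha c ⟨hc, hc'⟩
        refine ⟨M.mul_mem (M.mul_mem ha hc) (M.inv_mem ha), ?_⟩
        exact (inferInstance : (Subgroup.centralizer (A : Set H)).Normal).conj_mem c hc' a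
      · rintro a ha c ⟨hc, hc'⟩
        have := Subgroup.mem_centralizer_iff.1 hc' a ha
        rw [this, mul_inv_cancel_right]
        exact ⟨hc, hc'⟩
    intro m hm1
    have : (m : H) ∈ M ⊓ Subgroup.centralizer (A : Set H) := by
      refine ⟨m.2, Subgroup.mem_centralizer_iff.2 fun a ha => ?_⟩
      have h1 : φ m ⟨a, ha⟩ = ⟨a, ha⟩ := by rw [hm1]; rfl
      have h2 : (m : H) * a * (m : H)⁻¹ = a := congrArg Subtype.val h1
      exact (mul_inv_eq_iff_eq_mul.1 h2).symm
    rw [hC] at this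
    exact Subtype.ext this
  have hMc : ∀ a ∈ M, ∀ b ∈ M, a * b = b * a := by
    intro a ha b hb
    have : (⟨a, ha⟩ * ⟨b, hb⟩ : M) = ⟨b, hb⟩ * ⟨a, ha⟩ := by
      apply hφ
      apply (IsCyclic.mulAutMulEquiv A).injective
      rw [map_mul, map_mul, map_mul, map_mul, mul_comm]
    exact congrArg Subtype.val this
  obtain ⟨g, hg⟩ : ∃ g, M.comap (MulAut.conj g).toMonoidHom ≠ M := by
    by_contra! hc
    refine hMn ⟨fun n hn g => ?_⟩
    rw [← hc g] at hn
    exact hn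
  set M1 := M.comap (MulAut.conj g).toMonoidHom with hM1
  have hM1c : IsCoatom M1 := comap_conj_coatom hM g
  have hM1m : LMod M1 ⊤ := lmod_comap_top (MulAut.conj g).surjective hm
  have hMM1 : ¬ M ≤ M1 := fun h => by
    rcases hM.le_iff.1 h with h | h
    · exact hM1c.1 h
    · exact hg h
  have hM1comm : ∀ a ∈ M1, ∀ b ∈ M1, a * b = b * a := by
    intro a ha b hb
    have := hMc _ ha _ hb
    apply (MulAut.conj g).injective
    rw [map_mul, map_mul]
    exact this
  have htop : M ⊔ M1 = ⊤ := hM1c.2 _ (lt_of_le_of_ne le_sup_right fun e => hMM1 (e ▸ le_sup_left))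
  have hinf1 : M1 ⊓ M = ⊥ := by
    refine small _ (normal_of_normalized htop ?_ ?_) inf_le_right
    · rintro a ha c ⟨hc, hc'⟩
      rw [hMc a ha c hc', mul_inv_cancel_right]
      exact ⟨hc, hc'⟩
    · rintro a ha c ⟨hc, hc'⟩
      rw [hM1comm a ha c hc, mul_inv_cancel_right]
      exact ⟨hc, hc'⟩
  obtain ⟨hd1, -⟩ := coatom_subgroupOf hM1c hM1m hMM1
  have hbotM : M1.subgroupOf M = ⊥ := by
    rw [Subgroup.subgroupOf_eq_bot, disjoint_iff, hinf1]
  rw [hbotM] at hd1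
  have hs : (Nat.card M).Prime := card_prime_of_coatom_bot hd1
  have hdvd : Nat.card M ∣ Nat.card (MulAut A) := Subgroup.card_dvd_of_injective φ hφ
  rw [IsCyclic.card_mulAut, Nat.totient_prime hr] at hdvd
  have hlt : Nat.card M < Nat.card A := by
    have := Nat.le_of_dvd (by have := hr.two_le; omega) hdvd
    have := hr.two_le
    omega
  refine .inr ⟨⊥, A, inferInstance, hAn, bot_le, bot_le, Nat.card A, Nat.card M, hr, hs, hlt,
    Subgroup.relIndex_bot_left A, ?_⟩
  rw [← Subgroup.relIndex_top_right, ← hMA, Subgroup.relIndex_sup_right,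
    ← Subgroup.inf_relIndex_right, inf_comm, hinf, Subgroup.relIndex_bot_left]

theorem schmidt_simple {H : Type u} [Group H] [Finite H] {M : Subgroup H}
    (hM : IsCoatom M) (hm : LMod M ⊤) (hcore : M.normalCore = ⊥)
    (hIH : ∀ X : Subgroup H, X ≠ ⊤ → ∀ N : Subgroup X, IsCoatom N → LMod N ⊤ → SchmidtConc N)
    (hs : ∀ A : Subgroup H, A.Normal → A = ⊥ ∨ A = ⊤) : M.Normal := by
  have hnt : Nat.card H ≠ 1 := by
    intro h1
    apply hM.1
    have := (Nat.card_eq_one_iff_unique.1 h1).1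
    exact Subsingleton.elim _ _
  have hp := Nat.minFac_prime hnt
  set p := (Nat.card H).minFac with hpdef
  have := Fact.mk hp
  obtain ⟨P⟩ : Nonempty (Sylow p H) := Sylow.nonempty
  have hPb : (P : Subgroup H) ≠ ⊥ := P.ne_bot_of_dvd_card (Nat.minFac_dvd _)
  have hPt : (P : Subgroup H) = ⊤ → M.Normal := by
    intro e
    refine isPGroup_coatom_normal hp ?_ hM
    have := P.isPGroup'
    rw [e] at this
    exact this.of_equiv Subgroup.topEquiv
  set X := Subgroup.normalizer (P : Set H) with hX
  have hPX : (P : Subgroup H) ≤ X := Subgroup.le_normalizer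
  by_cases hXt : X = ⊤
  · have : (P : Subgroup H).Normal := Subgroup.normalizer_eq_top_iff.1 hXt
    rcases hs _ this with h | h
    · exact absurd h hPb
    · exact hPt h
  have hcomm : ⁅X, (P : Subgroup H)⁆ ≤ M.normalCore := by
    refine le_normalCore_of_forall fun g => ?_
    set M1 := M.comap (MulAut.conj g).toMonoidHom with hM1
    have hM1c : IsCoatom M1 := comap_conj_coatom hM g
    have hM1m : LMod M1 ⊤ := lmod_comap_top (MulAut.conj g).surjective hm
    by_cases hXM : X ≤ M1
    · refine le_trans ?_ hXM
      rw [Subgroup.commutator_le]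
      intro a ha b hb
      exact X.mul_mem (X.mul_mem (X.mul_mem ha (hPX hb)) (X.inv_mem ha)) (X.inv_mem (hPX hb))
    · obtain ⟨c1, c2⟩ := coatom_subgroupOf hM1c hM1m hXM
      have hPn : ((P : Subgroup H).subgroupOf X).Normal :=
        (Subgroup.normal_subgroupOf_iff_le_normalizer hPX).2 le_rfl
      have := (hIH X hXt _ c1 c2).comm_le c1 hPn hp
        (P.isPGroup'.of_equiv (Subgroup.subgroupOfEquivOfLe hPX).symm)
        (fun q hq hd => Nat.minFac_le_of_dvd hq.two_le (hd.trans X.card_subgroup_dvd_card))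
      rw [Subgroup.commutator_le] at this ⊢
      intro a ha b hb
      exact this ⟨a, ha⟩ trivial ⟨b, hPX hb⟩ hb
  rw [hcore, le_bot_iff, Subgroup.commutator_eq_bot_iff_le_centralizer] at hcomm
  have hcompl := MonoidHom.ker_transferSylow_isComplement' P hcomm
  rcases hs _ (MonoidHom.normal_ker (MonoidHom.transferSylow P hcomm)) with h | h
  · rw [h] at hcompl
    exact hPt (Subgroup.isComplement'_bot_left.1 hcompl)
  · rw [h] at hcompl
    exact absurd (Subgroup.isComplement'_top_left.1 hcompl) hPb

/-- The theorem of Schmidt on modular maximal subgroups. -/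
theorem schmidt_aux (n : ℕ) : ∀ (H : Type u) [Group H] [Finite H] (M : Subgroup H),
    Nat.card H = n → IsCoatom M → LMod M ⊤ → SchmidtConc M := by
  induction n using Nat.strong_induction_on with
  | _ n ih =>
    intro H _ _ M hn hM hm
    by_cases hcore : M.normalCore = ⊥
    · have hIH : ∀ X : Subgroup H, X ≠ ⊤ →
          ∀ N : Subgroup X, IsCoatom N → LMod N ⊤ → SchmidtConc N := by
        intro X hX N h1 h2
        refine ih (Nat.card X) ?_ X N rfl h1 h2
        rw [← hn]
        exact lt_of_le_of_ne (Subgroup.card_le_card_group X)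
          fun e => hX (Subgroup.eq_top_of_card_eq X e)
      by_cases hns : ∃ A : Subgroup H, A.Normal ∧ A ≠ ⊥ ∧ A ≠ ⊤
      · exact schmidt_nonsimple hM hm hcore hIH hns
      · refine .inl (schmidt_simple hM hm hcore hIH fun A hA => ?_)
        by_contra! hc
        exact hns ⟨A, hA, hc⟩
    · set N := M.normalCore with hN
      have hsurj : Function.Surjective (QuotientGroup.mk' N) := QuotientGroup.mk'_surjective N
      have e : (M.map (QuotientGroup.mk' N)).comap (QuotientGroup.mk' N) = M := by
        rw [Subgroup.comap_map_eq, QuotientGroup.ker_mk', sup_eq_left]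
        exact M.normalCore_le
      rw [← e]
      apply SchmidtConc.comap hsurj
      refine ih (Nat.card (H ⧸ N)) ?_ _ _ rfl ?_ ?_
      · rw [← hn, Subgroup.card_eq_card_quotient_mul_card_subgroup N]
        have h1 : 1 < Nat.card N := (Subgroup.one_lt_card_iff_ne_bot N).2 hcore
        have h2 : 0 < Nat.card (H ⧸ N) := Nat.card_pos
        nlinarith
      · apply map_coatom hsurj; rwa [e]
      · apply lmod_of_comap hsurj; rwa [e, Subgroup.comap_top]

theorem schmidt {H : Type u} [Group H] [Finite H] {M : Subgroup H}
    (hM : IsCoatom M) (hm : LMod M ⊤) : SchmidtConc M := schmidt_aux _ H M rfl hM hm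

end schmidt

section forward

theorem coatom_of_maximal_modular {H : Type u} [Group H] [Finite H] {M : Subgroup H}
    (hm : LMod M ⊤) (hmax : ∀ N : Subgroup H, LMod N ⊤ → M ≤ N → N ≠ ⊤ → N = M)
    (hn : ¬ M.Normal) : IsCoatom M := by
  set L := Subgroup.normalizer (M : Set H) with hL
  have hML : M ≤ L := Subgroup.le_normalizer
  have hLt : L ≠ ⊤ := fun h => hn (Subgroup.normalizer_eq_top_iff.1 h)
  -- every proper subgroup above `M` lies in `L`
  have key : ∀ Z : Subgroup H, M ≤ Z → Z ≠ ⊤ → Z ≤ L := by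
    have hex : ∃ n, ∃ x : H, x ∉ L ∧ orderOf x = n := by
      obtain ⟨x, hx⟩ : ∃ x, x ∉ L := by
        by_contra! hc
        exact hLt (eq_top_iff.2 fun x _ => hc x)
      exact ⟨_, x, hx, rfl⟩
    classical
    obtain ⟨x, hxL, hxn⟩ := Nat.find_spec hex
    have hsmall : ∀ y : H, orderOf y < orderOf x → y ∈ L := by
      intro y hy
      by_contra hc
      exact Nat.find_min hex (hxn ▸ hy) ⟨y, hc, rfl⟩
    -- `M` and `x` generate
    have hgen : M ⊔ Subgroup.zpowers x = ⊤ := by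
      have hconj : ∃ g ∈ Subgroup.zpowers x, ¬ M.comap (MulAut.conj g).toMonoidHom ≤ M := by
        by_contra! hc
        apply hxL
        rw [hL, Subgroup.mem_normalizer_iff]
        intro h
        constructor
        · intro hh
          refine hc x⁻¹ (Subgroup.inv_mem _ (Subgroup.mem_zpowers x)) ?_
          rw [Subgroup.mem_comap]
          simpa [mul_assoc] using hh
        · intro hh
          exact hc x (Subgroup.mem_zpowers x) hh
      obtain ⟨g, hg, hgM⟩ := hconj
      set M1 := M.comap (MulAut.conj g).toMonoidHom with hM1
      have hM1m : LMod M1 ⊤ := lmod_comap_top (MulAut.conj g).surjective hm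
      have ht : M ⊔ M1 = ⊤ := by
        by_contra hne
        have := hmax _ (hm.sup hM1m) le_sup_left hne
        exact hgM (this ▸ le_sup_right)
      rw [eq_top_iff, ← ht]
      refine sup_le le_sup_left fun y hy => ?_
      set W := M ⊔ Subgroup.zpowers x with hW
      have h1 : g ∈ W := Subgroup.mem_sup_right hg
      have h2 : g * y * g⁻¹ ∈ W := Subgroup.mem_sup_left hy
      have h3 := W.mul_mem (W.mul_mem (W.inv_mem h1) h2) h1
      simpa [mul_assoc] using h3
    intro Z hMZ hZ
    have h1 := hm.2.2 (Subgroup.zpowers x) Z hMZ le_top le_top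
    rw [hgen, top_inf_eq] at h1
    refine h1.trans (sup_le hML ?_)
    rintro y ⟨hyx, hyZ⟩
    apply hsmall
    have hxZ : x ∉ Z := by
      intro hx
      apply hZ
      rw [eq_top_iff, ← hgen]
      exact sup_le hMZ ((Subgroup.zpowers_le).2 hx)
    have hdvd : orderOf y ∣ orderOf x := by
      obtain ⟨k, rfl⟩ := hyx
      exact orderOf_dvd_of_mem_zpowers ⟨k, rfl⟩
    refine lt_of_le_of_ne (Nat.le_of_dvd (orderOf_pos x) hdvd) fun e => hxZ ?_
    have hle : Subgroup.zpowers y ≤ Subgroup.zpowers x := (Subgroup.zpowers_le).2 hyx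
    have heq : Subgroup.zpowers y = Subgroup.zpowers x :=
      Subgroup.eq_of_le_of_card_ge hle (by rw [Nat.card_zpowers, Nat.card_zpowers, e])
    have : x ∈ Subgroup.zpowers y := heq ▸ Subgroup.mem_zpowers x
    exact (Subgroup.zpowers_le.2 hyZ) this
  have hLmod : LMod L ⊤ := by
    refine ⟨le_top, fun x y hxy _ => ?_, fun x y hLy _ _ => ?_⟩
    · by_cases hxL : x ≤ L
      · rw [sup_eq_right.2 hxL]; exact le_sup_right
      · have ht : x ⊔ M = ⊤ := by
          by_contra hne
          exact hxL (le_sup_left.trans (key _ le_sup_right hne))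
        have := hm.2.1 x y hxy le_top
        rw [ht, top_inf_eq] at this
        exact inf_le_right.trans (this.trans (sup_le_sup_left (inf_le_inf_right _ hML) _))
    · by_cases hy : y = ⊤
      · rw [hy, inf_top_eq, inf_top_eq]
      · exact inf_le_right.trans ((key y (hML.trans hLy) hy).trans le_sup_left)
  have hLM : L = M := hmax L hLmod hML hLt
  refine ⟨fun e => hLt (hLM.trans e), fun b hb => ?_⟩
  by_contra hbt
  exact hb.not_ge (hLM ▸ key b hb.le hbt)

theorem coatom_gen {H : Type*} [Group H] {M : Subgroup H} (h : IsCoatom M) :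
    ∃ y, ⊤ = M ⊔ Subgroup.zpowers y := by
  obtain ⟨y, hy⟩ : ∃ y, y ∉ M := by
    by_contra! hc
    exact h.1 (eq_top_iff.2 fun x _ => hc x)
  refine ⟨y, (h.2 _ ?_).symm⟩
  refine lt_of_le_of_ne le_sup_left fun e => hy ?_
  rw [e]; exact Subgroup.mem_sup_right (Subgroup.mem_zpowers y)

theorem u1_of_card {K : Type u} [Group K] [Finite K] {A : Subgroup K} (hA : A.Normal) {r s : ℕ}
    (hr : r.Prime) (hs : s.Prime) (hrs : s < r) (h1 : Nat.card A = r) (h2 : A.index = s) :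
    U1 K := by
  constructor
  · have := Fact.mk hr
    obtain ⟨a, ha⟩ := (isCyclic_of_prime_card h1).exists_zpow_surjective
    obtain ⟨y, hy⟩ := coatom_gen (coatom_of_index_prime (h2 ▸ hs))
    refine ⟨2, ![⊥, A, ⊤], rfl, rfl, ?_, ?_⟩
    · intro i
      fin_cases i
      · exact (inferInstance : (⊥ : Subgroup K).Normal)
      · exact hA
      · exact (inferInstance : (⊤ : Subgroup K).Normal)
    · intro i
      fin_cases i
      · refine ⟨a, ?_⟩
        change A = ⊥ ⊔ Subgroup.zpowers (a : K)
        rw [bot_sup_eq]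
        refine le_antisymm (fun x hx => ?_) (Subgroup.zpowers_le.2 a.2)
        obtain ⟨k, hk⟩ := ha ⟨x, hx⟩
        exact ⟨k, congrArg Subtype.val hk⟩
      · exact ⟨y, hy⟩
  · have hc : Nat.card K = r * s := by rw [← A.card_mul_index, h1, h2]
    refine Squarefree.squarefree_of_dvd Group.exponent_dvd_nat_card ?_
    rw [hc, Nat.squarefree_mul ((Nat.coprime_primes hr hs).2 (by omega))]
    exact ⟨hr.prime.squarefree, hs.prime.squarefree⟩

theorem exists_forward_step {H : Type u} [Group H] [Finite H] {M : Subgroup H}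
    (hm : LMod M ⊤) (hM : M ≠ ⊤) :
    ∃ N : Subgroup H, M ≤ N ∧ N ≠ ⊤ ∧ (N.Normal ∨ fResidual U1 H ≤ N) := by
  obtain ⟨N, hMN, ⟨hN1, hN2⟩, hNmax⟩ := exists_maximal_ge_of_wellFoundedGT
    (fun N : Subgroup H => LMod N ⊤ ∧ N ≠ ⊤) M ⟨hm, hM⟩
  refine ⟨N, hMN, hN2, ?_⟩
  by_cases hn : N.Normal
  · exact .inl hn
  have hc : IsCoatom N := coatom_of_maximal_modular hN1
    (fun K h1 h2 h3 => le_antisymm (hNmax ⟨h1, h3⟩ h2) h2) hn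
  rcases schmidt hc hN1 with h | ⟨D, A, hD, hA, hDA, hDM, r, s, hr, hs, hsr, h1, h2⟩
  · exact .inl h
  · refine .inr (le_trans (sInf_le ⟨hD, ?_⟩) hDM)
    have hsurj := QuotientGroup.mk'_surjective D
    have e : (A.map (QuotientGroup.mk' D)).comap (QuotientGroup.mk' D) = A := by
      rw [Subgroup.comap_map_eq, QuotientGroup.ker_mk', sup_eq_left]
      exact hDA
    refine u1_of_card (A := A.map (QuotientGroup.mk' D)) (hA.map _ hsurj) hr hs hsr ?_ ?_
    · rw [← Subgroup.relIndex_ker, QuotientGroup.ker_mk', h1]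
    · rw [← Subgroup.index_comap_of_surjective _ hsurj, e, h2]

theorem KSubnormal.of_lmod {G : Type u} [Group G] [Finite G] {Q K : Subgroup G}
    (h : KSubnormal U1 Q K) : ∀ (n : ℕ) (L : Subgroup G), Nat.card L = n → LMod K L →
    KSubnormal U1 Q L := by
  intro n
  induction n using Nat.strong_induction_on with
  | _ n ih =>
    intro L hn hm
    by_cases hKL : K = L
    · exact hKL ▸ h
    have hKL' : K.subgroupOf L ≠ ⊤ := fun e =>
      hKL (le_antisymm hm.1 (Subgroup.subgroupOf_eq_top.1 e))
    obtain ⟨N, h1, h2, h3⟩ := exists_forward_step ((lmod_subgroupOf hm.1).2 hm) hKL'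
    have hNL : N.map L.subtype ≤ L := Subgroup.map_subtype_le N
    have hKN : K ≤ N.map L.subtype := by
      have := (map_le_iff_sub (L := L)).2 h1
      rwa [Subgroup.map_subgroupOf_eq_of_le hm.1] at this
    have e : (N.map L.subtype).subgroupOf L = N :=
      Subgroup.comap_map_eq_self_of_injective L.subtype_injective N
    refine .step (ih (Nat.card (N.map L.subtype)) ?_ (N.map L.subtype) rfl (hm.mono hKN hNL))
      hNL ?_
    · rw [← hn]
      refine lt_of_le_of_ne (Subgroup.card_le_of_le hNL) fun he => h2 ?_
      have := Subgroup.eq_of_le_of_card_ge hNL he.ge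
      rw [← e, this, Subgroup.subgroupOf_self]
    · rw [e]; exact h3

theorem forward {G : Type u} [Group G] [Finite G] {Q L : Subgroup G} (h : Submodular Q L) :
    KSubnormal U1 Q L := by
  induction h with
  | refl => exact .refl _
  | step _ h1 h2 ih => exact ih.of_lmod _ _ rfl ((isModular_sub_iff h1).1 h2)

end forward

section backward

theorem lmod_of_relIndex {G : Type*} [Group G] [Finite G] {D K L : Subgroup G} (hDK : D ≤ K)
    (hKL : K ≤ L) (hD : LMod D L) {p r : ℕ} (hp : p.Prime) (hr : r.Prime)
    (h1 : D.relIndex K = p) (h2 : K.relIndex L = r) : LMod K L := by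
  have htot : D.relIndex L = p * r := by
    rw [← Subgroup.relIndex_mul_relIndex D K L hDK hKL, h1, h2]
  have hatom : ∀ X, D ≤ X → X ≤ K → X = D ∨ X = K := by
    intro X hX hXK
    have h := Subgroup.relIndex_mul_relIndex D X K hX hXK
    rw [h1] at h
    rcases (Nat.dvd_prime hp).1 ⟨_, h.symm⟩ with h3 | h3
    · exact .inl (le_antisymm (Subgroup.relIndex_eq_one.1 h3) hX)
    · right
      rw [h3] at h
      have : X.relIndex K = 1 := by have := hp.pos; nlinarith
      exact le_antisymm hXK (Subgroup.relIndex_eq_one.1 this)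
  have hcoatom : ∀ X, K ≤ X → X ≤ L → X = K ∨ X = L := by
    intro X hX hXK
    have h := Subgroup.relIndex_mul_relIndex K X L hX hXK
    rw [h2] at h
    rcases (Nat.dvd_prime hr).1 ⟨_, h.symm⟩ with h3 | h3
    · exact .inl (le_antisymm (Subgroup.relIndex_eq_one.1 h3) hX)
    · right
      rw [h3] at h
      have : X.relIndex L = 1 := by have := hr.pos; nlinarith
      exact le_antisymm hXK (Subgroup.relIndex_eq_one.1 this)
  have hheight : ∀ X Y, D ≤ X → X ≤ Y → Y ≤ L → X ≠ D → Y ≠ L → X = Y := by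
    intro X Y hX hXY hYL hXD hYne
    have h3 := Subgroup.relIndex_mul_relIndex D Y L (hX.trans hXY) hYL
    have h4 := Subgroup.relIndex_mul_relIndex D X Y hX hXY
    rw [htot, ← h4] at h3
    have n1 : D.relIndex X ≠ 1 := fun e => hXD (le_antisymm (Subgroup.relIndex_eq_one.1 e) hX)
    have n2 : Y.relIndex L ≠ 1 := fun e => hYne (le_antisymm hYL (Subgroup.relIndex_eq_one.1 e))
    by_contra hne
    have n3 : X.relIndex Y ≠ 1 := fun e => hne (le_antisymm hXY (Subgroup.relIndex_eq_one.1 e))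
    have hlen := congrArg ArithmeticFunction.cardFactors h3
    have hpos : D.relIndex X * X.relIndex Y * Y.relIndex L ≠ 0 := by
      rw [h3]; exact (Nat.mul_pos hp.pos hr.pos).ne'
    have z12 := left_ne_zero_of_mul hpos
    rw [ArithmeticFunction.cardFactors_mul z12 (right_ne_zero_of_mul hpos),
      ArithmeticFunction.cardFactors_mul (left_ne_zero_of_mul z12) (right_ne_zero_of_mul z12),
      ArithmeticFunction.cardFactors_mul hp.ne_zero hr.ne_zero,
      ArithmeticFunction.cardFactors_apply_prime hp,
      ArithmeticFunction.cardFactors_apply_prime hr] at hlen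
    have q : ∀ n : ℕ, n ≠ 0 → n ≠ 1 → ArithmeticFunction.cardFactors n ≠ 0 := by
      intro n h0 h1 h
      rw [ArithmeticFunction.cardFactors_eq_zero_iff_eq_zero_or_one] at h
      tauto
    have q1 := q _ (left_ne_zero_of_mul z12) n1
    have q2 := q _ (right_ne_zero_of_mul z12) n3
    have q3 := q _ (right_ne_zero_of_mul hpos) n2
    omega
  refine LMod.of_interval hD hDK hKL ?_ ?_
  · intro x y hx hxy hy
    by_cases hKy : K ≤ y
    · rw [inf_eq_left.2 hKy]; exact inf_le_left
    have hy' : y ≠ L := fun e => hKy (e ▸ hKL)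
    rcases hcoatom (x ⊔ K) le_sup_right (sup_le (hxy.trans hy) hKL) with h | h
    · rw [h]; exact le_sup_right
    · have hxD : x ≠ D := by
        rintro rfl
        rw [sup_eq_right.2 hDK] at h
        rw [h] at h2
        rw [Subgroup.relIndex_self] at h2
        exact hr.one_lt.ne h2
      rw [hheight x y hx hxy hy hxD hy']
      exact inf_le_right.trans le_sup_left
  · intro x y hx hKy hy hxl
    rcases hcoatom y hKy hy with h | h
    · rw [h]; exact inf_le_right.trans le_sup_left
    · rw [h, inf_eq_left.2 hxl]; exact inf_le_left

theorem card_mul_relIndex_of_le {G : Type*} [Group G] {A B : Subgroup G} (h : A ≤ B) :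
    Nat.card A * A.relIndex B = Nat.card B := by
  have := Subgroup.relIndex_mul_relIndex ⊥ A B bot_le h
  rwa [Subgroup.relIndex_bot_left, Subgroup.relIndex_bot_left] at this

theorem submodular_sup_prime {G : Type u} [Group G] [Finite G] {Q R : Subgroup G} {p r : ℕ}
    (hp : p.Prime) (hQ : IsPGroup p Q) (hsq : Squarefree (Monoid.exponent G)) (hR : R.Normal)
    (hr : r.Prime) (hRr : Nat.card R = r) : LMod Q (Q ⊔ R) := by
  have := Fact.mk hr
  have hcycR : IsCyclic R := isCyclic_of_prime_card hRr
  let e : MulAut R ≃* (ZMod (Nat.card R))ˣ := IsCyclic.mulAutMulEquiv R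
  have hcyc : IsCyclic (MulAut R) := by
    have : Fact (Nat.card R).Prime := ⟨hRr ▸ hr⟩
    exact isCyclic_of_surjective e.symm e.symm.surjective
  let φ : G →* MulAut R := MulAut.conjNormal
  set D := φ.ker ⊓ Q with hD
  have hDQ : D ≤ Q := inf_le_right
  have hDL : LMod D (Q ⊔ R) := by
    refine lmod_of_normal_sub (hDQ.trans le_sup_left) ?_
    rw [Subgroup.normal_subgroupOf_iff_le_normalizer (hDQ.trans le_sup_left)]
    have key : ∀ E : Subgroup G, (∀ a ∈ E, ∀ c ∈ D, a * c * a⁻¹ ∈ D) →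
        E ≤ Subgroup.normalizer (D : Set G) := by
      intro E hE a ha
      rw [Subgroup.mem_normalizer_iff]
      refine fun c => ⟨hE a ha c, fun hc => ?_⟩
      have := hE a⁻¹ (E.inv_mem ha) _ hc
      simpa [mul_assoc] using this
    refine sup_le (key Q ?_) (key R ?_)
    · rintro a ha c ⟨hc, hc'⟩
      exact ⟨(MonoidHom.normal_ker φ).conj_mem c hc a, Q.mul_mem (Q.mul_mem ha hc') (Q.inv_mem ha)⟩
    · rintro a ha c ⟨hc, hc'⟩
      have h1 : φ c ⟨a, ha⟩ = ⟨a, ha⟩ := by rw [MonoidHom.mem_ker.1 hc]; rfl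
      have h2 : c * a * c⁻¹ = a := congrArg Subtype.val h1
      have h3 : c * a = a * c := mul_inv_eq_iff_eq_mul.1 h2
      rw [← h3, mul_inv_cancel_right]
      exact ⟨hc, hc'⟩
  have hDidx : D.relIndex Q = 1 ∨ D.relIndex Q = p := by
    have h1 : D.relIndex Q = Nat.card (Q.map φ) := by
      rw [hD, Subgroup.inf_relIndex_right, Subgroup.relIndex_ker]
    rw [h1]
    have hpg : IsPGroup p (Q.map φ) := hQ.map φ
    have := Fact.mk hp
    obtain ⟨k, hk⟩ := IsPGroup.iff_card.1 hpg
    obtain ⟨⟨x, hxm⟩, hx⟩ := (inferInstance : IsCyclic (Q.map φ)).exists_ofOrder_eq_natCard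
    have h2 : Nat.card (Q.map φ) ∣ Monoid.exponent G := by
      obtain ⟨q, hq, hqx⟩ := hxm
      rw [← hx, ← Subgroup.orderOf_coe]
      change orderOf x ∣ _
      rw [← hqx]
      exact (orderOf_map_dvd φ q).trans (Monoid.order_dvd_exponent q)
    rw [hk] at h2 ⊢
    have hsq2 := hsq.squarefree_of_dvd h2
    have : k ≤ 1 := by
      by_contra! hlt
      have hd : p * p ∣ p ^ k := by
        rw [← pow_two]; exact pow_dvd_pow p hlt
      exact hp.one_lt.ne' (Nat.isUnit_iff.1 (hsq2 p hd))
    interval_cases k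
    · left; simp
    · right; simp
  have hQL : Q.relIndex (Q ⊔ R) ∣ r := by
    have h1 : R.relIndex (Q ⊔ R) = R.relIndex Q := Subgroup.relIndex_sup_right Q R
    have h2 : Nat.card R * R.relIndex (Q ⊔ R) = Nat.card ↥(Q ⊔ R) :=
      card_mul_relIndex_of_le le_sup_right
    have h3 : Nat.card Q * Q.relIndex (Q ⊔ R) = Nat.card ↥(Q ⊔ R) :=
      card_mul_relIndex_of_le le_sup_left
    have h4 : Nat.card ↥(R ⊓ Q) * R.relIndex Q = Nat.card Q := by
      rw [← Subgroup.inf_relIndex_right]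
      exact card_mul_relIndex_of_le inf_le_right
    rw [h1, hRr, ← h3, ← h4] at h2
    have hpos : 0 < R.relIndex Q := Nat.pos_of_ne_zero fun e => by
      rw [e, mul_zero] at h4
      exact Nat.card_pos.ne h4
    refine ⟨Nat.card ↥(R ⊓ Q), Nat.eq_of_mul_eq_mul_right hpos ?_⟩
    rw [h2]; ring
  rcases hDidx with h | h
  · rw [← le_antisymm hDQ (Subgroup.relIndex_eq_one.1 h)]
    have : D = Q := le_antisymm hDQ (Subgroup.relIndex_eq_one.1 h)
    rw [this] at hDL ⊢
    exact hDL
  rcases (Nat.dvd_prime hr).1 hQL with h' | h'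
  · have : Q ⊔ R = Q := le_antisymm (Subgroup.relIndex_eq_one.1 h') le_sup_left
    rw [this]; exact LMod.rfl' Q
  · exact lmod_of_relIndex hDQ le_sup_left hDL hp hr h h'

theorem exists_normal_prime {G : Type u} [Group G] [Finite G] (hG : IsSupersolvable G)
    (hnt : Nat.card G ≠ 1) : ∃ R : Subgroup G, R.Normal ∧ (Nat.card R).Prime := by
  obtain ⟨n, s, h0, h1, hn, hs⟩ := hG
  obtain ⟨g, hg, hg1⟩ : ∃ g : G, (Subgroup.zpowers g).Normal ∧ g ≠ 1 := by
    by_contra! hc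
    have hbot : ∀ i : Fin (n + 1), s i = ⊥ := by
      intro i
      induction i using Fin.induction with
      | zero => exact h0
      | succ i ih =>
        obtain ⟨g, hg⟩ := hs i
        rw [ih, bot_sup_eq] at hg
        have := hn i.succ
        rw [hg] at this ⊢
        rw [hc g this, Subgroup.zpowers_one_eq_bot]
    rw [hbot] at h1
    apply hnt
    rw [← Subgroup.card_top (G := G), ← h1, Subgroup.card_bot]
  have ho : orderOf g ≠ 1 := fun h => hg1 (orderOf_eq_one_iff.1 h)
  have hr := Nat.minFac_prime ho
  set r := (orderOf g).minFac
  obtain ⟨k, hk⟩ : r ∣ orderOf g := Nat.minFac_dvd _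
  have hk0 : k ≠ 0 := fun h => (orderOf_pos g).ne' (by rw [hk, h, mul_zero])
  refine ⟨Subgroup.zpowers (g ^ k), ⟨?_⟩, ?_⟩
  · rintro _ ⟨j, rfl⟩ x
    obtain ⟨l, hl⟩ := hg.conj_mem g (Subgroup.mem_zpowers g) x
    have hl : g ^ l = x * g * x⁻¹ := hl
    refine ⟨l * j, ?_⟩
    change (g ^ k) ^ (l * j) = x * (g ^ k) ^ j * x⁻¹
    rw [← conj_zpow, ← conj_pow, ← hl, ← zpow_natCast, ← zpow_natCast, ← zpow_mul, ← zpow_mul,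
      ← zpow_mul]
    congr 1; ring
  · rw [Nat.card_zpowers, orderOf_pow_of_dvd hk0 ⟨r, by rw [hk, mul_comm]⟩, hk,
      Nat.mul_div_cancel _ (Nat.pos_of_ne_zero hk0)]
    exact hr

theorem U1.quot {G : Type u} [Group G] (h : U1 G) (N : Subgroup G) [N.Normal] :
    U1 (G ⧸ N) := by
  obtain ⟨⟨n, s, h0, h1, hn, hs⟩, hsq⟩ := h
  have hsurj := QuotientGroup.mk'_surjective N
  refine ⟨⟨n, fun i => (s i).map (QuotientGroup.mk' N), ?_, ?_, fun i => (hn i).map _ hsurj, ?_⟩, ?_⟩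
  · simp only [h0, Subgroup.map_bot]
  · simp only [h1]; exact Subgroup.map_top_of_surjective _ hsurj
  · intro i
    obtain ⟨g, hg⟩ := hs i
    refine ⟨QuotientGroup.mk' N g, ?_⟩
    simp only [hg, Subgroup.map_sup, MonoidHom.map_zpowers]
  · exact hsq.squarefree_of_dvd (MonoidHom.exponent_dvd hsurj)

theorem submodular_of_u1 {p : ℕ} (hp : p.Prime) (n : ℕ) : ∀ (G : Type u) [Group G] [Finite G]
    (Q : Subgroup G), Nat.card G = n → U1 G → IsPGroup p Q → Submodular Q ⊤ := by
  induction n using Nat.strong_induction_on with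
  | _ n ih =>
    intro G _ _ Q hn hG hQ
    by_cases hnt : Nat.card G = 1
    · have := (Nat.card_eq_one_iff_unique.1 hnt).1
      rw [Subsingleton.elim Q ⊤]
      exact .refl _
    obtain ⟨R, hR, hRp⟩ := exists_normal_prime hG.1 hnt
    have hsurj := QuotientGroup.mk'_surjective R
    have h1 : Submodular (Q.map (QuotientGroup.mk' R)) ⊤ := by
      refine ih (Nat.card (G ⧸ R)) ?_ _ _ rfl (hG.quot R) (hQ.map _)
      rw [← hn, Subgroup.card_eq_card_quotient_mul_card_subgroup R]
      have h1 : 1 < Nat.card R := hRp.one_lt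
      have h2 : 0 < Nat.card (G ⧸ R) := Nat.card_pos
      nlinarith
    have h2 := h1.comap' hsurj
    rw [Subgroup.comap_map_eq, QuotientGroup.ker_mk', Subgroup.comap_top] at h2
    exact (Submodular.of_lmod (submodular_sup_prime hp hQ hG.2 hR hRp rfl)).trans' h2

theorem pow_card_mem {G : Type*} [Group G] {Q N : Subgroup G} (hN : N.Normal) {t : G}
    (ht : t ∈ Q ⊔ N) : t ^ Nat.card Q ∈ N := by
  obtain ⟨a, ha, b, hb, rfl⟩ := Subgroup.mem_sup_of_normal_right.1 ht
  rw [← QuotientGroup.eq_one_iff, QuotientGroup.mk_pow, QuotientGroup.mk_mul,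
    (QuotientGroup.eq_one_iff b).2 hb, mul_one, ← QuotientGroup.mk_pow]
  have : (⟨a, ha⟩ : Q) ^ Nat.card Q = 1 := pow_card_eq_one'
  rw [show a ^ Nat.card Q = 1 from congrArg Subtype.val this]
  rfl

theorem exists_small {G : Type u} [Group G] [Finite G] {p : ℕ} (hp : p.Prime) {Q K : Subgroup G}
    (hQ : IsPGroup p Q) (hQK : Q ≤ K) (hK : fResidual U1 G ≤ K) :
    ∃ T, Q ≤ T ∧ T ≤ K ∧ Submodular T ⊤ := by
  obtain ⟨T, -, ⟨hQT, hTs⟩, hTmin⟩ := exists_minimal_le_of_wellFoundedLT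
    (fun T : Subgroup G => Q ≤ T ∧ Submodular T ⊤) ⊤ ⟨le_top, .refl _⟩
  refine ⟨T, hQT, ?_, hTs⟩
  -- minimality
  have key : ∀ S : Subgroup G, Q ≤ S → ∀ Z, Submodular S Z → T ≤ Z → T ≤ S := by
    intro S hQS Z hSZ hTZ
    have h1 := hSZ.inf' T
    rw [inf_eq_right.2 hTZ] at h1
    exact (hTmin ⟨le_inf hQS hQT, h1.trans' hTs⟩ inf_le_right).trans inf_le_left
  have hpow : ∀ t ∈ T, t ^ Nat.card Q ∈ fResidual U1 G := by
    intro t ht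
    rw [fResidual, Subgroup.mem_sInf]
    rintro N ⟨hN, hNU⟩
    refine pow_card_mem hN (key (Q ⊔ N) le_sup_left ⊤ ?_ le_top ht)
    have h1 : Submodular (Q.map (QuotientGroup.mk' N)) ⊤ :=
      submodular_of_u1 hp _ _ _ rfl hNU (hQ.map _)
    have h2 := h1.comap' (QuotientGroup.mk'_surjective N)
    rwa [Subgroup.comap_map_eq, QuotientGroup.ker_mk', Subgroup.comap_top] at h2
  have hFn : (fResidual U1 G).Normal := by
    refine ⟨fun x hx g => ?_⟩
    rw [fResidual, Subgroup.mem_sInf] at hx ⊢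
    rintro N ⟨hN, hNU⟩
    exact hN.conj_mem x (hx N ⟨hN, hNU⟩) g
  by_contra hTK
  have hne : K.subgroupOf T ≠ ⊤ := fun e => hTK (Subgroup.subgroupOf_eq_top.1 e)
  obtain ⟨S, hSc, hKS⟩ := (eq_top_or_exists_le_coatom (K.subgroupOf T)).resolve_left hne
  have hSn : S.Normal := by
    set F := (fResidual U1 G).subgroupOf T with hF
    have hFS : F ≤ S := (Subgroup.comap_mono hK).trans hKS
    have hsurj := QuotientGroup.mk'_surjective F
    have e : (S.map (QuotientGroup.mk' F)).comap (QuotientGroup.mk' F) = S := by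
      rw [Subgroup.comap_map_eq, QuotientGroup.ker_mk', sup_eq_left]
      exact hFS
    rw [← e]
    refine Subgroup.Normal.comap ?_ _
    refine isPGroup_coatom_normal hp ?_ (map_coatom hsurj (by rwa [e]))
    have := Fact.mk hp
    obtain ⟨k, hk⟩ := IsPGroup.iff_card.1 hQ
    intro x
    obtain ⟨t, rfl⟩ := hsurj x
    refine ⟨k, ?_⟩
    rw [← map_pow, ← hk]
    exact (QuotientGroup.eq_one_iff _).2 (hpow t t.2)
  have hS' : Submodular (S.map T.subtype) T := by
    have := lmod_map_iff.2 (lmod_of_normal hSn)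
    rw [← MonoidHom.range_eq_map, Subgroup.range_subtype] at this
    exact .of_lmod this
  have hQS : Q ≤ S.map T.subtype := fun q hq => ⟨⟨q, hQT hq⟩, hKS (hQK hq), rfl⟩
  have hTS := key _ hQS T hS' le_rfl
  apply hSc.1
  refine eq_top_iff.2 fun x _ => ?_
  obtain ⟨z, hz, hzx⟩ := hTS x.2
  have : z = x := Subtype.ext hzx
  exact this ▸ hz

theorem KSubnormal.le {F : ∀ (G : Type u) [Group G], Prop} {G : Type u} [Group G]
    {H K : Subgroup G} (h : KSubnormal F H K) : H ≤ K := by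
  induction h with
  | refl => exact le_rfl
  | step _ h _ ih => exact ih.trans h

theorem backward {G : Type u} [Group G] [Finite G] {p : ℕ} (hp : p.Prime) {Q L : Subgroup G}
    (hQ : IsPGroup p Q) (h : KSubnormal U1 Q L) : Submodular Q L := by
  induction h with
  | refl => exact .refl _
  | @step K L hk h1 h2 ih =>
    rcases h2 with h2 | h2
    · exact (ih).step' (lmod_of_normal_sub h1 h2)
    · have hQK : Q ≤ K := hk.le
      have hQL : Q ≤ L := hQK.trans h1
      obtain ⟨T, t1, t2, t3⟩ := exists_small hp (Q := Q.subgroupOf L) (K := K.subgroupOf L)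
        (hQ.of_equiv (Subgroup.subgroupOfEquivOfLe hQL).symm) (Subgroup.comap_mono hQK) h2
      have t4 := t3.map_sub
      rw [← MonoidHom.range_eq_map, Subgroup.range_subtype] at t4
      have t5 := map_le_iff_sub.2 t1
      have t6 := map_le_iff_sub.2 t2
      rw [Subgroup.map_subgroupOf_eq_of_le hQL] at t5
      rw [Subgroup.map_subgroupOf_eq_of_le h1] at t6
      have := (ih).inf' (T.map L.subtype)
      rw [inf_eq_left.2 t5, inf_eq_right.2 t6] at this
      exact this.trans' t4

end backward

/-- A primary subgroup is submodular iff it is K𝔘₁-subnormal. -/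
theorem stmt12 {G : Type u} [Group G] [Finite G] {Q : Subgroup G}
    {p : ℕ} (hp : p.Prime) (hQ : IsPGroup p Q) :
    Submodular Q ⊤ ↔ KSubnormal U1 Q ⊤ :=
  ⟨forward, backward hp hQ⟩
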